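/- Let (Λ,η) be an isothermic surface in S^n with Darboux transforms (Λ₁,η₁) and (Λ₂,η₂) of distinct spectral parameters m₁ ≠ m₂, with Λ₁ ∩ Λ₂ = {0}, and let Λ̂ := Γ_Λ^{Λ₁}(1 − m₂/m₁)(Λ₂) with η̂ := Ad(Γ_{Λ₂}^{Λ₁}(m₂/m₁))η be the Bianchi permutability fourth surface, which is simultaneously a Darboux transform of (Λ₁,η₁) with parameter m₂ and of (Λ₂,η₂) with parameter m₁. If (Λ,η) is special isothermic of type d ∈ ℕ₀ with respect to a polynomial conserved quantity p(t) such that p(m₁) is a section of Λ₁^⊥ and p(m₂) is a section of Λ₂^⊥, then (Λ̂,η̂) is special isothermic of type d with respect to a polynomial conserved quantity p̂(t) satisfying p̂(0) = p(0) and (p̂(t),p̂(t)) = (p(t),p(t)) as polynomials in t. -/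

import Mathlib

noncomputable section

open Finset

/-- Minkowski space `ℝ^{n+1,1}`, modelled on `Fin (n+2) → ℝ`. -/
abbrev MV (n : ℕ) : Type := EuclideanSpace ℝ (Fin (n + 2))

/-- The Minkowski inner product of signature `(n+1,1)`. -/
def mink (n : ℕ) (x y : MV n) : ℝ :=
  ∑ i : Fin (n + 1), x i.castSucc * y i.castSucc
    - x (Fin.last (n + 1)) * y (Fin.last (n + 1))

/-- The light cone `L ⊂ ℝ^{n+1,1}`. -/
def LightCone (n : ℕ) : Set (MV n) := {v | v ≠ 0 ∧ mink n v v = 0}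

/-- The skew endomorphism `u ∧ v`, acting by `(u ∧ v) w = (u,w)v − (v,w)u`. -/
def wedge (n : ℕ) (u v w : MV n) : MV n :=
  mink n u w • v - mink n v w • u

/-- The surface domain: a two-dimensional coordinate chart. -/
abbrev Surf : Type := ℝ × ℝ

/-- the coordinate direction ∂/∂u -/
def du : Surf := (1, 0)

/-- the coordinate direction ∂/∂v -/
def dv : Surf := (0, 1)

/-- partial derivative of a section in a coordinate direction -/
def pd {n : ℕ} (e : Surf) (f : Surf → MV n) (x : Surf) : MV n :=
  fderiv ℝ f x e

lemma mink_add_left (n : ℕ) (a b c : MV n) :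
    mink n (a + b) c = mink n a c + mink n b c := by
  simp [mink, PiLp.add_apply, add_mul, Finset.sum_add_distrib]; ring

lemma mink_smul_left (n : ℕ) (r : ℝ) (a c : MV n) :
    mink n (r • a) c = r * mink n a c := by
  simp [mink, PiLp.smul_apply, smul_eq_mul, mul_sub, Finset.mul_sum, mul_assoc]

lemma mink_zero_left (n : ℕ) (c : MV n) : mink n 0 c = 0 := by
  simp [mink]

/-- An isothermic surface `(Λ,η)` in `S^n = P(L)`, given by a nowhere-zero null
lift `F` of the immersion `Λ` together with the 1-form
`η = F ∧ W₁ du + F ∧ W₂ dv` with values in `Λ ∧ Λ^⊥`. -/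
structure IsothermicSurface (n : ℕ) : Type where
  F : Surf → MV n
  W₁ : Surf → MV n
  W₂ : Surf → MV n
  smooth_F : ContDiff ℝ (⊤ : ℕ∞) F
  smooth_W₁ : ContDiff ℝ (⊤ : ℕ∞) W₁
  smooth_W₂ : ContDiff ℝ (⊤ : ℕ∞) W₂
  F_ne : ∀ x, F x ≠ 0
  F_null : ∀ x, mink n (F x) (F x) = 0
  immersed : ∀ x, LinearIndependent ℝ ![F x, pd du F x, pd dv F x]
  W₁_perp : ∀ x, mink n (F x) (W₁ x) = 0
  W₂_perp : ∀ x, mink n (F x) (W₂ x) = 0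
  eta_ne : ∃ x z, wedge n (F x) (W₁ x) z ≠ 0 ∨ wedge n (F x) (W₂ x) z ≠ 0
  eta_closed : ∀ x z,
    fderiv ℝ (fun y => wedge n (F y) (W₂ y) z) x du
      = fderiv ℝ (fun y => wedge n (F y) (W₁ y) z) x dv

/-- `s` is a parallel section for the flat connection `∇^t = d + tη`. -/
def ParallelSection (n : ℕ) (S : IsothermicSurface n) (t : ℝ)
    (s : Surf → MV n) : Prop :=
  ∀ x, fderiv ℝ s x du + t • wedge n (S.F x) (S.W₁ x) (s x) = 0
     ∧ fderiv ℝ s x dv + t • wedge n (S.F x) (S.W₂ x) (s x) = 0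

/-- A polynomial conserved quantity of degree `d` of the isothermic surface
`(Λ,η)`: a polynomial `p(t) = Σ_{k=0}^d p_k t^k` of (smooth) sections, of exact
degree `d`, with `∇^t p(t) = 0` for all `t`. -/
structure PolyConservedQuantity (n : ℕ) (S : IsothermicSurface n) (d : ℕ) : Type where
  coeff : ℕ → Surf → MV n
  smooth : ∀ k, ContDiff ℝ (⊤ : ℕ∞) (coeff k)
  coeff_eq_zero : ∀ k, d < k → coeff k = 0
  top_ne : coeff d ≠ 0
  conserved : ∀ t : ℝ, ParallelSection n S t
    (fun x => ∑ k ∈ Finset.range (d + 1), t ^ k • coeff k x)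

/-- evaluation `p(t)` of a polynomial conserved quantity -/
def pcEval {n : ℕ} {S : IsothermicSurface n} {d : ℕ}
    (p : PolyConservedQuantity n S d) (t : ℝ) (x : Surf) : MV n :=
  ∑ k ∈ Finset.range (d + 1), t ^ k • p.coeff k x

/-- `(Λ,η)` is a special isothermic surface of type `d`. -/
def SpecialOfType (n : ℕ) (S : IsothermicSurface n) (d : ℕ) : Prop :=
  Nonempty (PolyConservedQuantity n S d)

/-- `p₀ ∈ ⟨w⟩`: the polynomial conserved quantity exhibits `(Λ,η)` as special
isothermic in the space-form `E(w)`. -/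
def InSpaceForm {n : ℕ} {S : IsothermicSurface n} {d : ℕ}
    (p : PolyConservedQuantity n S d) (w : MV n) : Prop :=
  ∃ c : ℝ, ∀ x, p.coeff 0 x = c • w

/-- fullness: the image of `Λ` lies in no proper subsphere -/
def Full (n : ℕ) (S : IsothermicSurface n) : Prop :=
  ¬ ∃ p : MV n, p ≠ 0 ∧ ∀ x, mink n p (S.F x) = 0
/-- A Darboux transform `Λ̂` of `(Λ,η)` with parameter `m`, given by a
`∇^m`-parallel null lift `G` spanning an immersed surface with `Λ̂ ∩ Λ = 0`. -/
structure DarbouxTransform (n : ℕ) (S : IsothermicSurface n) (m : ℝ) : Type where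
  G : Surf → MV n
  smooth_G : ContDiff ℝ (⊤ : ℕ∞) G
  G_ne : ∀ x, G x ≠ 0
  G_null : ∀ x, mink n (G x) (G x) = 0
  immersed : ∀ x, LinearIndependent ℝ ![G x, pd du G x, pd dv G x]
  disjoint : ∀ x, G x ∉ Submodule.span ℝ {S.F x}
  parallel : ParallelSection n S m G

/-- The gauge transformation `Γ_{⟨F⟩}^{⟨G⟩}(c)`: acts as `c` on `⟨G⟩`, as `1` on
`(⟨F⟩ ⊕ ⟨G⟩)^⊥` and as `c⁻¹` on `⟨F⟩`. -/
def gaugeG (n : ℕ) (F G : MV n) (c : ℝ) (z : MV n) : MV n :=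
  ((mink n G z / mink n F G) / c) • F
    + (c * (mink n F z / mink n F G)) • G
    + (z - (mink n G z / mink n F G) • F - (mink n F z / mink n F G) • G)

/-- `Γ_Λ^{Λ̂}(1 − t/m) · (d + tη) = d + tη̂` for all `t ≠ m`: the gauge relation
between the pencils of flat connections of an isothermic surface `S` and of (an
isothermic structure `T` on) its Darboux transform with parameter `m`. -/
def GaugeRel (n : ℕ) (S T : IsothermicSurface n) (m : ℝ) : Prop :=
  ∀ t : ℝ, t ≠ m → ∀ s : Surf → MV n, ContDiff ℝ (⊤ : ℕ∞) s → ∀ x : Surf,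
    (fderiv ℝ (fun y => gaugeG n (S.F y) (T.F y) (1 - t / m) (s y)) x du
        + t • wedge n (T.F x) (T.W₁ x) (gaugeG n (S.F x) (T.F x) (1 - t / m) (s x))
      = gaugeG n (S.F x) (T.F x) (1 - t / m)
          (fderiv ℝ s x du + t • wedge n (S.F x) (S.W₁ x) (s x)))
    ∧ (fderiv ℝ (fun y => gaugeG n (S.F y) (T.F y) (1 - t / m) (s y)) x dv
        + t • wedge n (T.F x) (T.W₂ x) (gaugeG n (S.F x) (T.F x) (1 - t / m) (s x))
      = gaugeG n (S.F x) (T.F x) (1 - t / m)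
          (fderiv ℝ s x dv + t • wedge n (S.F x) (S.W₂ x) (s x)))

/-- `Λ̂ = ⟨p(m)⟩` with `(p(m),p(m)) = 0`: the Darboux transform `D` is a
complementary surface of `(Λ,η)` with respect to `p(t)`. -/
def IsComplementary (n : ℕ) {S : IsothermicSurface n} {d : ℕ}
    (p : PolyConservedQuantity n S d) {m : ℝ} (D : DarbouxTransform n S m) : Prop :=
  (∀ x, mink n (pcEval p m x) (pcEval p m x) = 0) ∧
  (∀ x, Submodule.span ℝ {D.G x} = Submodule.span ℝ {pcEval p m x})

/-- `m` is a repeated root of the (constant-coefficient) polynomial `(p(t),p(t))`. -/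
def IsRepeatedRootAt {n : ℕ} {S : IsothermicSurface n} {d : ℕ}
    (p : PolyConservedQuantity n S d) (m : ℝ) : Prop :=
  ∀ x, mink n (pcEval p m x) (pcEval p m x) = 0
    ∧ deriv (fun t : ℝ => mink n (pcEval p t x) (pcEval p t x)) m = 0
/-- metric coefficient `g₁₁ = (F_u,F_u)` of the induced metric -/
def gUU (n : ℕ) (F : Surf → MV n) (x : Surf) : ℝ := mink n (pd du F x) (pd du F x)

/-- metric coefficient `g₁₂ = (F_u,F_v)` -/
def gUV (n : ℕ) (F : Surf → MV n) (x : Surf) : ℝ := mink n (pd du F x) (pd dv F x)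

/-- metric coefficient `g₂₂ = (F_v,F_v)` -/
def gVV (n : ℕ) (F : Surf → MV n) (x : Surf) : ℝ := mink n (pd dv F x) (pd dv F x)

/-- `(𝐇, N)`, the inner product of the mean curvature vector of `F` (in a
space-form `E(w)`) with a normal field `N`: half the trace with respect to the
induced metric of the `N`-component of the second fundamental form. -/
def meanCurv (n : ℕ) (F N : Surf → MV n) (x : Surf) : ℝ :=
  (gVV n F x * mink n (pd du (pd du F) x) (N x)
    - 2 * gUV n F x * mink n (pd du (pd dv F) x) (N x)
    + gUU n F x * mink n (pd dv (pd dv F) x) (N x))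
  / (2 * (gUU n F x * gVV n F x - gUV n F x ^ 2))

/-- `N` is a unit normal field of the lift `F : Σ → E(w)`. -/
def IsUnitNormal (n : ℕ) (F N : Surf → MV n) (w : MV n) : Prop :=
  (∀ x, mink n (N x) (N x) = 1) ∧ (∀ x, mink n (N x) w = 0)
    ∧ (∀ x, mink n (N x) (F x) = 0)
    ∧ (∀ x, mink n (N x) (pd du F x) = 0) ∧ (∀ x, mink n (N x) (pd dv F x) = 0)

/-- `N` is parallel for the normal connection of `F : Σ → E(w)`: the derivative
of `N` has no component in the normal bundle of `F` in `E(w)`. -/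
def ParallelNormal (n : ℕ) (F N : Surf → MV n) (w : MV n) : Prop :=
  ∀ x e, fderiv ℝ N x e ∈ Submodule.span ℝ {F x, pd du F x, pd dv F x, w}

/-- the chart coordinates `(u,v)` are conformal curvature line coordinates
corresponding to `η`, with conformal factor `e^{2θ}`:
`I = e^{2θ}(du² + dv²)` and `η = e^{−2θ} F ∧ (−F_u du + F_v dv)`. -/
def ConformalCoords (n : ℕ) (S : IsothermicSurface n) (θ : Surf → ℝ) : Prop :=
  ContDiff ℝ (⊤ : ℕ∞) θ
  ∧ (∀ x, mink n (pd du S.F x) (pd du S.F x) = Real.exp (2 * θ x))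
  ∧ (∀ x, mink n (pd dv S.F x) (pd dv S.F x) = Real.exp (2 * θ x))
  ∧ (∀ x, mink n (pd du S.F x) (pd dv S.F x) = 0)
  ∧ (∀ x z, wedge n (S.F x) (S.W₁ x) z
      = Real.exp (-(2 * θ x)) • wedge n (S.F x) (-pd du S.F x) z)
  ∧ (∀ x z, wedge n (S.F x) (S.W₂ x) z
      = Real.exp (-(2 * θ x)) • wedge n (S.F x) (pd dv S.F x) z)

/-- the second fundamental form of the lift `F` in `E(w)` with respect to the
unit normal `N` is `II = e^{2θ}(k₁ du² + k₂ dv²)`. -/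
def PrincipalCurvatures (n : ℕ) (S : IsothermicSurface n) (N : Surf → MV n)
    (θ k₁ k₂ : Surf → ℝ) : Prop :=
  (∀ x, mink n (pd du (pd du S.F) x) (N x) = Real.exp (2 * θ x) * k₁ x)
  ∧ (∀ x, mink n (pd du (pd dv S.F) x) (N x) = 0)
  ∧ (∀ x, mink n (pd dv (pd dv S.F) x) (N x) = Real.exp (2 * θ x) * k₂ x)

/-- partial derivative of a real function on the surface -/
def pdR (e : Surf) (f : Surf → ℝ) (x : Surf) : ℝ := fderiv ℝ f x e
/-- `(Λ^c, η^c)` is the Christoffel transform of `(Λ,η)` with respect to the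
pair `(v∞, v₀)`, witnessed by the stereoprojections `f`, `f^c` into
`ℝ^n = ⟨v₀,v∞⟩^⊥`:  `F = exp(f ∧ v∞)v₀`, `F^c = exp(f^c ∧ v₀)v∞`,
`η = Ad(exp(f ∧ v∞))(df^c ∧ v₀)` and `η^c = Ad(exp(f^c ∧ v₀))(df ∧ v∞)`. -/
def IsChristoffelPair (n : ℕ) (S Sc : IsothermicSurface n) (vinf v0 : MV n)
    (f fc : Surf → MV n) : Prop :=
  vinf ∈ LightCone n ∧ v0 ∈ LightCone n ∧ mink n v0 vinf = -1
  ∧ ContDiff ℝ (⊤ : ℕ∞) f ∧ ContDiff ℝ (⊤ : ℕ∞) fc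
  ∧ (∀ x, mink n (f x) v0 = 0) ∧ (∀ x, mink n (f x) vinf = 0)
  ∧ (∀ x, mink n (fc x) v0 = 0) ∧ (∀ x, mink n (fc x) vinf = 0)
  ∧ (∀ x, S.F x = v0 + f x + (mink n (f x) (f x) / 2) • vinf)
  ∧ (∀ x, Sc.F x = vinf + fc x + (mink n (fc x) (fc x) / 2) • v0)
  ∧ (∀ x z, wedge n (S.F x) (S.W₁ x) z
      = wedge n (pd du fc x + mink n (f x) (pd du fc x) • vinf) (S.F x) z)
  ∧ (∀ x z, wedge n (S.F x) (S.W₂ x) z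
      = wedge n (pd dv fc x + mink n (f x) (pd dv fc x) • vinf) (S.F x) z)
  ∧ (∀ x z, wedge n (Sc.F x) (Sc.W₁ x) z
      = wedge n (pd du f x + mink n (fc x) (pd du f x) • v0) (Sc.F x) z)
  ∧ (∀ x z, wedge n (Sc.F x) (Sc.W₂ x) z
      = wedge n (pd dv f x + mink n (fc x) (pd dv f x) • v0) (Sc.F x) z)

/-- `Φ` is an orthogonal gauge transformation with `Φ · (d + sη) = d`. -/
def IsTGauge (n : ℕ) (S : IsothermicSurface n) (s : ℝ)
    (Φ : Surf → MV n → MV n) : Prop :=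
  (∀ x, IsLinearMap ℝ (Φ x))
  ∧ (∀ x z z', mink n (Φ x z) (Φ x z') = mink n z z')
  ∧ (∀ σ : Surf → MV n, ContDiff ℝ (⊤ : ℕ∞) σ → ∀ x,
      (fderiv ℝ (fun y => Φ y (σ y)) x du
         = Φ x (fderiv ℝ σ x du + s • wedge n (S.F x) (S.W₁ x) (σ x)))
      ∧ (fderiv ℝ (fun y => Φ y (σ y)) x dv
         = Φ x (fderiv ℝ σ x dv + s • wedge n (S.F x) (S.W₂ x) (σ x))))

/-- `(Λ_s, η_s)` is the T-transform of `(Λ,η)` associated to `Φ_s`: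
`Λ_s = Φ_s Λ` and `η_s = Ad(Φ_s) η`. -/
def IsTTransform (n : ℕ) (S : IsothermicSurface n) (s : ℝ)
    (Φ : Surf → MV n → MV n) (Ss : IsothermicSurface n) : Prop :=
  IsTGauge n S s Φ
  ∧ (∀ x, Ss.F x = Φ x (S.F x))
  ∧ (∀ x z, wedge n (Ss.F x) (Ss.W₁ x) (Φ x z) = Φ x (wedge n (S.F x) (S.W₁ x) z))
  ∧ (∀ x z, wedge n (Ss.F x) (Ss.W₂ x) (Φ x z) = Φ x (wedge n (S.F x) (S.W₂ x) z))

/-- orthogonal complement with respect to the Minkowski form -/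
def mperp (n : ℕ) (U : Submodule ℝ (MV n)) : Submodule ℝ (MV n) where
  carrier := {v | ∀ u ∈ U, mink n v u = 0}
  add_mem' := by
    intro a b ha hb u hu
    rw [mink_add_left, ha u hu, hb u hu, add_zero]
  zero_mem' := by
    intro u hu; exact mink_zero_left n u
  smul_mem' := by
    intro r a ha u hu
    rw [mink_smul_left, ha u hu, mul_zero]

/-- the spherical system of `Λ` and a Darboux transform `Λ̂ = ⟨G⟩`: the
`(n−2)`-sphere congruence `C = Λ ⊕ Λ̂ ⊕ V_R^⊥`, `V_R = Λ^{(1)} ⊕ Λ̂`. -/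
def sphericalSystem (n : ℕ) (S : IsothermicSurface n) (G : Surf → MV n)
    (x : Surf) : Submodule ℝ (MV n) :=
  Submodule.span ℝ {S.F x, G x}
    ⊔ mperp n (Submodule.span ℝ {S.F x, pd du S.F x, pd dv S.F x, G x})

/-- the sphere-planes congruence `P = C + ⟨w⟩` of `Λ` and `Λ̂ = ⟨G⟩` with
respect to `w`. -/
def spherePlanes (n : ℕ) (S : IsothermicSurface n) (G : Surf → MV n)
    (w : MV n) (x : Surf) : Submodule ℝ (MV n) :=
  sphericalSystem n S G x ⊔ Submodule.span ℝ {w}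
/-- the lift `Γ_Λ^{Λ₁}(1 − m₂/m₁)(G₂)` of the Bianchi permutability fourth
surface `Λ̂` -/
def permutLift (n : ℕ) (S : IsothermicSurface n) (m₁ m₂ : ℝ)
    (D₁ : DarbouxTransform n S m₁) (D₂ : DarbouxTransform n S m₂) :
    Surf → MV n :=
  fun x => gaugeG n (S.F x) (D₁.G x) (1 - m₂ / m₁) (D₂.G x)

/-- `T` is the Bianchi permutability fourth surface
`Λ̂ = Γ_Λ^{Λ₁}(1 − m₂/m₁)(Λ₂)` with `η̂ = Ad(Γ_{Λ₂}^{Λ₁}(m₂/m₁)) η`. -/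
def IsPermutabilityFourth (n : ℕ) (S : IsothermicSurface n) (m₁ m₂ : ℝ)
    (D₁ : DarbouxTransform n S m₁) (D₂ : DarbouxTransform n S m₂)
    (T : IsothermicSurface n) : Prop :=
  (∀ x, T.F x = permutLift n S m₁ m₂ D₁ D₂ x)
  ∧ (∀ x z, wedge n (T.F x) (T.W₁ x) (gaugeG n (D₂.G x) (D₁.G x) (m₂ / m₁) z)
      = gaugeG n (D₂.G x) (D₁.G x) (m₂ / m₁) (wedge n (S.F x) (S.W₁ x) z))
  ∧ (∀ x z, wedge n (T.F x) (T.W₂ x) (gaugeG n (D₂.G x) (D₁.G x) (m₂ / m₁) z)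
      = gaugeG n (D₂.G x) (D₁.G x) (m₂ / m₁) (wedge n (S.F x) (S.W₂ x) z))

section MinkowskiForm

variable {n : ℕ}

lemma mink_comm (x y : MV n) : mink n x y = mink n y x := by
  simp [mink, mul_comm]

lemma mink_add_right (x y z : MV n) : mink n x (y + z) = mink n x y + mink n x z := by
  rw [mink_comm, mink_add_left, mink_comm y, mink_comm z]

lemma mink_smul_right (r : ℝ) (x y : MV n) : mink n x (r • y) = r * mink n x y := by
  rw [mink_comm, mink_smul_left, mink_comm y]

lemma mink_neg_left (x y : MV n) : mink n (-x) y = -mink n x y := by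
  rw [← neg_one_smul ℝ x, mink_smul_left, neg_one_mul]

lemma mink_neg_right (x y : MV n) : mink n x (-y) = -mink n x y := by
  rw [mink_comm, mink_neg_left, mink_comm]

lemma mink_sub_left (x y z : MV n) : mink n (x - y) z = mink n x z - mink n y z := by
  rw [sub_eq_add_neg, mink_add_left, mink_neg_left, ← sub_eq_add_neg]

lemma mink_sub_right (x y z : MV n) : mink n x (y - z) = mink n x y - mink n x z := by
  rw [mink_comm, mink_sub_left, mink_comm y, mink_comm z]

/-- The Minkowski inner product as a continuous bilinear form. -/
def minkForm (n : ℕ) : MV n →L[ℝ] MV n →L[ℝ] ℝ :=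
  (LinearMap.mk₂ ℝ (mink n) (mink_add_left n) (mink_smul_left n)
    mink_add_right mink_smul_right).toContinuousBilinearMap

lemma minkForm_apply (x y : MV n) : minkForm n x y = mink n x y := rfl

lemma mink_sum_left {ι : Type*} (s : Finset ι) (f : ι → MV n) (y : MV n) :
    mink n (∑ i ∈ s, f i) y = ∑ i ∈ s, mink n (f i) y := by
  simp [← minkForm_apply]

lemma contDiff_mink {f g : Surf → MV n} (hf : ContDiff ℝ (⊤ : ℕ∞) f)
    (hg : ContDiff ℝ (⊤ : ℕ∞) g) : ContDiff ℝ (⊤ : ℕ∞) fun x => mink n (f x) (g x) := by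
  simp only [← minkForm_apply]
  fun_prop

lemma fderiv_mink {f g : Surf → MV n} {x : Surf} (hf : DifferentiableAt ℝ f x)
    (hg : DifferentiableAt ℝ g x) (e : Surf) :
    fderiv ℝ (fun y => mink n (f y) (g y)) x e
      = mink n (fderiv ℝ f x e) (g x) + mink n (f x) (fderiv ℝ g x e) := by
  have h := (minkForm n).hasFDerivAt_of_bilinear hf.hasFDerivAt hg.hasFDerivAt
  simp only [minkForm_apply] at h
  rw [h.fderiv]
  simp [minkForm_apply, add_comm]

lemma wedge_add (u v x y : MV n) : wedge n u v (x + y) = wedge n u v x + wedge n u v y := by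
  simp only [wedge, mink_add_right]
  module

lemma wedge_smul (u v : MV n) (r : ℝ) (x : MV n) :
    wedge n u v (r • x) = r • wedge n u v x := by
  simp only [wedge, mink_smul_right]
  module

lemma mink_wedge_left (u v x y : MV n) :
    mink n (wedge n u v x) y = -mink n x (wedge n u v y) := by
  simp only [wedge, mink_sub_left, mink_sub_right, mink_smul_left, mink_smul_right,
    mink_comm x u, mink_comm x v]
  ring

lemma eq_zero_of_mink_self_of_last {x : MV n} (h : mink n x x = 0)
    (hlast : x (Fin.last (n + 1)) = 0) : x = 0 := by
  have hsum : ∑ i : Fin (n + 1), x i.castSucc * x i.castSucc = 0 := by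
    simpa [mink, hlast] using h
  rw [Finset.sum_eq_zero_iff_of_nonneg fun i _ => mul_self_nonneg _] at hsum
  ext i
  induction i using Fin.lastCases with
  | last => simpa using hlast
  | cast i => simpa using hsum i (Finset.mem_univ i)

/-- Orthogonal null vectors of Minkowski space are proportional. -/
lemma mem_span_of_mink_eq_zero {x y : MV n} (hx : mink n x x = 0) (hy : mink n y y = 0)
    (hy0 : y ≠ 0) (hxy : mink n x y = 0) : x ∈ Submodule.span ℝ {y} := by
  have hlast : y (Fin.last (n + 1)) ≠ 0 := fun h => hy0 (eq_zero_of_mink_self_of_last hy h)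
  have hz : y (Fin.last (n + 1)) • x - x (Fin.last (n + 1)) • y = 0 := by
    apply eq_zero_of_mink_self_of_last
    · simp [mink_sub_left, mink_sub_right, mink_smul_left, mink_smul_right, hx, hy, hxy,
        mink_comm y x]
    · simp [mul_comm]
  refine Submodule.mem_span_singleton.2
    ⟨(y (Fin.last (n + 1)))⁻¹ * x (Fin.last (n + 1)), ?_⟩
  rw [mul_smul, ← sub_eq_zero.1 hz, smul_smul, inv_mul_cancel₀ hlast, one_smul]

end MinkowskiForm

section SyntheticDivision

variable {V : Type*} [AddCommGroup V] [Module ℝ V]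

/-- The coefficients of the quotient of `∑_{k ≤ d} t^k a_k` by `t - m`. -/
def quotCoeff (m : ℝ) (d : ℕ) (a : ℕ → V) (j : ℕ) : V :=
  ∑ k ∈ Finset.range (d + 1), if j < k then m ^ (k - 1 - j) • a k else 0

lemma sub_smul_sum_quotCoeff (m : ℝ) (d : ℕ) (a : ℕ → V) (t : ℝ) :
    (t - m) • ∑ j ∈ Finset.range d, t ^ j • quotCoeff m d a j
      = ∑ k ∈ Finset.range (d + 1), t ^ k • a k
        - ∑ k ∈ Finset.range (d + 1), m ^ k • a k := by
  simp only [quotCoeff, Finset.smul_sum]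
  rw [Finset.sum_comm, ← Finset.sum_sub_distrib]
  refine Finset.sum_congr rfl fun k hk => ?_
  have hkd : k ≤ d := Nat.lt_succ_iff.1 (Finset.mem_range.1 hk)
  rw [← sub_smul, ← geom_sum₂_mul t m k, mul_comm, mul_smul, Finset.sum_smul, Finset.smul_sum]
  rw [← Finset.sum_subset (Finset.range_subset_range.2 hkd)]
  · refine Finset.sum_congr rfl fun j hj => ?_
    rw [if_pos (Finset.mem_range.1 hj), smul_smul (t ^ j)]
  · intro j _ hj
    rw [if_neg (by simpa using hj), smul_zero, smul_zero]

lemma quotCoeff_of_le (m : ℝ) {d j : ℕ} (hj : d ≤ j) (a : ℕ → V) : quotCoeff m d a j = 0 :=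
  Finset.sum_eq_zero fun k hk => if_neg (by have := Finset.mem_range.1 hk; omega)

lemma quotCoeff_last (m : ℝ) (d : ℕ) (a : ℕ → V) : quotCoeff m (d + 1) a d = a (d + 1) := by
  rw [quotCoeff, Finset.sum_range_succ, Finset.sum_eq_zero]
  · simp
  · intro k hk
    exact if_neg (by have := Finset.mem_range.1 hk; omega)

end SyntheticDivision

section Permutability

variable {n : ℕ}

/-- The correction terms by which the conserved quantity of the fourth surface of a Bianchi
quadrilateral differs from the original one, divided by the spectral parameter: here `a` and `b`
are the quotients of the conserved quantity by `t - m₂` and `t - m₁`. -/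
def permutCorrection (m₁ m₂ : ℝ) (G₁ G₂ a b : MV n) : MV n :=
  ((m₂ - m₁) / m₁ * (mink n a G₂ / mink n G₁ G₂)) • G₁
    + ((m₁ - m₂) / m₂ * (mink n b G₁ / mink n G₁ G₂)) • G₂

lemma sum_smul_permutCorrection (m₁ m₂ : ℝ) (G₁ G₂ : MV n) (s : Finset ℕ) (c : ℕ → ℝ)
    (a b : ℕ → MV n) :
    ∑ j ∈ s, c j • permutCorrection m₁ m₂ G₁ G₂ (a j) (b j)
      = permutCorrection m₁ m₂ G₁ G₂ (∑ j ∈ s, c j • a j) (∑ j ∈ s, c j • b j) := by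
  simp only [permutCorrection, mink_sum_left, mink_smul_left, Finset.sum_div, Finset.mul_sum,
    Finset.sum_smul, ← Finset.sum_add_distrib]
  refine Finset.sum_congr rfl fun j _ => ?_
  module

lemma mink_self_add_permutCorrection {m₁ m₂ t : ℝ} (hm₁ : m₁ ≠ 0) (hm₂ : m₂ ≠ 0)
    {G₁ G₂ s a b : MV n} (hG₁ : mink n G₁ G₁ = 0) (hG₂ : mink n G₂ G₂ = 0)
    (hg : mink n G₁ G₂ ≠ 0) (ha : (t - m₂) * mink n a G₂ = mink n s G₂)
    (hb : (t - m₁) * mink n b G₁ = mink n s G₁) :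
    mink n (s + t • permutCorrection m₁ m₂ G₁ G₂ a b)
      (s + t • permutCorrection m₁ m₂ G₁ G₂ a b) = mink n s s := by
  simp only [permutCorrection, mink_add_left, mink_add_right, mink_smul_left, mink_smul_right,
    mink_comm G₂ G₁, mink_comm G₁ s, mink_comm G₂ s, hG₁, hG₂, ← ha, ← hb]
  field_simp
  ring

/-- The top coefficient of the transformed conserved quantity does not vanish. -/
lemma add_permutCorrection_ne_zero {m₁ m₂ : ℝ} (hm₁ : m₁ ≠ 0) (hm₂ : m₂ ≠ 0)
    {G₁ G₂ s : MV n} (hG₁ : mink n G₁ G₁ = 0) (hG₂ : mink n G₂ G₂ = 0)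
    (hg : mink n G₁ G₂ ≠ 0) (hs : s ≠ 0) :
    s + permutCorrection m₁ m₂ G₁ G₂ s s ≠ 0 := by
  intro h
  have h₂ : mink n s G₂ = 0 := by
    have := congrArg (fun z => mink n z G₂) h
    simp only [permutCorrection, mink_add_left, mink_smul_left, hG₂, mink_zero_left] at this
    field_simp at this
    exact mul_right_cancel₀ (mul_ne_zero (pow_ne_zero 2 hm₂) hg) (by linear_combination this)
  have h₁ : mink n s G₁ = 0 := by
    have := congrArg (fun z => mink n z G₁) h
    simp only [permutCorrection, mink_add_left, mink_smul_left, hG₁, mink_zero_left,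
      mink_comm G₂ G₁] at this
    field_simp at this
    exact mul_right_cancel₀ (mul_ne_zero (pow_ne_zero 2 hm₁) hg) (by linear_combination this)
  exact hs (by simpa [permutCorrection, h₁, h₂] using h)

lemma add_permutCorrection_eq_gaugeG {m₁ m₂ t : ℝ} (hm₁ : m₁ ≠ 0) (hm₂ : m₂ ≠ 0)
    {G₁ G₂ s a b : MV n} (hG₁ : mink n G₁ G₁ = 0) (hG₂ : mink n G₂ G₂ = 0)
    (hg : mink n G₁ G₂ ≠ 0) (ha : (t - m₂) * mink n a G₂ = mink n s G₂)
    (hb : (t - m₁) * mink n b G₁ = mink n s G₁) :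
    s + t • permutCorrection m₁ m₂ G₁ G₂ a b = gaugeG n G₂ G₁ (m₂ / m₁)
      (s + (m₂ - m₁) • ((mink n a G₂ / mink n G₁ G₂) • G₁
        - (mink n b G₁ / mink n G₁ G₂) • G₂)) := by
  simp only [gaugeG, permutCorrection, mink_add_right, mink_sub_right, mink_smul_right,
    mink_comm G₂ G₁, mink_comm G₁ s, mink_comm G₂ s, hG₁, hG₂, ← ha, ← hb]
  match_scalars <;> field_simp <;> ring

/-- Infinitesimal form of the gauge relation between the original surface and the fourth
surface: `A` and `B` are the functions multiplying `G₁` and `G₂`, with derivatives `A'`, `B'`. -/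
lemma gauge_relation_permutCorrection {m₁ m₂ t A' B' : ℝ} (hm₁ : m₁ ≠ 0) (hm₂ : m₂ ≠ 0)
    {F W F' W' G₁ G₂ s a b : MV n} (hG₁ : mink n G₁ G₁ = 0) (hG₂ : mink n G₂ G₂ = 0)
    (hg : mink n G₁ G₂ ≠ 0) (ha : (t - m₂) * mink n a G₂ = mink n s G₂)
    (hb : (t - m₁) * mink n b G₁ = mink n s G₁)
    (hgauge : ∀ z, wedge n F' W' (gaugeG n G₂ G₁ (m₂ / m₁) z)
      = gaugeG n G₂ G₁ (m₂ / m₁) (wedge n F W z))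
    (hA : A' * mink n G₁ G₂ = mink n s (wedge n F W G₂)
      - (m₁ - m₂) * (mink n a G₂ / mink n G₁ G₂) * mink n G₁ (wedge n F W G₂))
    (hB : B' * mink n G₁ G₂ = mink n s (wedge n F W G₁)
      - (m₁ - m₂) * (mink n b G₁ / mink n G₁ G₂) * mink n G₁ (wedge n F W G₂)) :
    -(t • wedge n F W s)
      + t • ((m₂ - m₁) / m₁) • (A' • G₁ - (mink n a G₂ / mink n G₁ G₂) • m₁ • wedge n F W G₁)
      + t • ((m₁ - m₂) / m₂) • (B' • G₂ - (mink n b G₁ / mink n G₁ G₂) • m₂ • wedge n F W G₂)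
      + t • wedge n F' W' (s + t • permutCorrection m₁ m₂ G₁ G₂ a b) = 0 := by
  rw [add_permutCorrection_eq_gaugeG hm₁ hm₂ hG₁ hG₂ hg ha hb, hgauge]
  have skew (y : MV n) : mink n y (wedge n F W y) = 0 := by
    have := mink_wedge_left F W y y
    rw [mink_comm] at this
    linarith
  have skew_comm (x y : MV n) : mink n x (wedge n F W y) = -mink n y (wedge n F W x) := by
    rw [mink_comm, mink_wedge_left]
  obtain rfl := eq_div_of_mul_eq hg hA
  obtain rfl := eq_div_of_mul_eq hg hB
  simp only [sub_eq_add_neg (_ • G₁), ← neg_smul, wedge_add, wedge_smul]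
  simp only [gaugeG, mink_add_right, mink_smul_right, mink_comm G₂ G₁, skew,
    skew_comm G₁ s, skew_comm G₂ s, skew_comm G₂ G₁]
  match_scalars <;> field_simp <;> ring

/-- The gauge relation in the direction `e`, for sections with the given covariant derivatives. -/
lemma fderiv_add_permutCorrection {m₁ m₂ t : ℝ} (hm₁ : m₁ ≠ 0) (hm₂ : m₂ ≠ 0)
    {s a b G₁ G₂ : Surf → MV n} (hs : Differentiable ℝ s) (hda : Differentiable ℝ a)
    (hdb : Differentiable ℝ b) (hdG₁ : Differentiable ℝ G₁) (hdG₂ : Differentiable ℝ G₂)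
    (hG₁ : ∀ x, mink n (G₁ x) (G₁ x) = 0) (hG₂ : ∀ x, mink n (G₂ x) (G₂ x) = 0)
    (hg : ∀ x, mink n (G₁ x) (G₂ x) ≠ 0)
    (ha : ∀ x, (t - m₂) * mink n (a x) (G₂ x) = mink n (s x) (G₂ x))
    (hb : ∀ x, (t - m₁) * mink n (b x) (G₁ x) = mink n (s x) (G₁ x))
    (ht₁ : t ≠ m₁) (ht₂ : t ≠ m₂) {x e : Surf} {F W F' W' : MV n}
    (hgauge : ∀ z, wedge n F' W' (gaugeG n (G₂ x) (G₁ x) (m₂ / m₁) z)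
      = gaugeG n (G₂ x) (G₁ x) (m₂ / m₁) (wedge n F W z))
    (ps : fderiv ℝ s x e + t • wedge n F W (s x) = 0)
    (pG₁ : fderiv ℝ G₁ x e + m₁ • wedge n F W (G₁ x) = 0)
    (pG₂ : fderiv ℝ G₂ x e + m₂ • wedge n F W (G₂ x) = 0) :
    fderiv ℝ (fun y => s y + t • permutCorrection m₁ m₂ (G₁ y) (G₂ y) (a y) (b y)) x e
      + t • wedge n F' W'
        (s x + t • permutCorrection m₁ m₂ (G₁ x) (G₂ x) (a x) (b x)) = 0 := by
  have diff_mink {f g : Surf → MV n} (hf : Differentiable ℝ f) (hg : Differentiable ℝ g) :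
      Differentiable ℝ fun y => mink n (f y) (g y) := by
    simp only [← minkForm_apply]
    fun_prop
  rw [add_eq_zero_iff_eq_neg] at ps pG₁ pG₂
  have dg := fderiv_mink (hdG₁ x) (hdG₂ x) e
  rw [pG₁, pG₂, mink_neg_left, mink_neg_right, mink_smul_left, mink_smul_right,
    mink_wedge_left] at dg
  set A : Surf → ℝ := fun y => mink n (a y) (G₂ y) / mink n (G₁ y) (G₂ y) with hAdef
  set B : Surf → ℝ := fun y => mink n (b y) (G₁ y) / mink n (G₁ y) (G₂ y) with hBdef
  have hdA : Differentiable ℝ A := (diff_mink hda hdG₂).mul ((diff_mink hdG₁ hdG₂).inv hg)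
  have hdB : Differentiable ℝ B := (diff_mink hdb hdG₁).mul ((diff_mink hdG₁ hdG₂).inv hg)
  -- The derivative of a coefficient `C` satisfying `(t - m) C (G₁, G₂) = (s, G)`.
  have deriv_coeff {C : Surf → ℝ} {G : Surf → MV n} {m : ℝ} (hC : Differentiable ℝ C)
      (hG : Differentiable ℝ G) (htm : t ≠ m)
      (h : ∀ y, (t - m) * (C y * mink n (G₁ y) (G₂ y)) = mink n (s y) (G y))
      (pG : fderiv ℝ G x e = -(m • wedge n F W (G x))) :
      fderiv ℝ C x e * mink n (G₁ x) (G₂ x) = mink n (s x) (wedge n F W (G x))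
        - (m₁ - m₂) * C x * mink n (G₁ x) (wedge n F W (G₂ x)) := by
    have hfd := congrArg (fun f => fderiv ℝ f x e) (funext h)
    rw [fderiv_mink (hs x) (hG x) e, ps, pG,
      fderiv_const_mul ((hC x).fun_mul (diff_mink hdG₁ hdG₂ x)),
      fderiv_fun_mul (hC x) (diff_mink hdG₁ hdG₂ x), mink_neg_left, mink_neg_right,
      mink_smul_left, mink_smul_right, mink_wedge_left] at hfd
    simp only [smul_apply, add_apply, smul_eq_mul,
      dg] at hfd
    refine mul_left_cancel₀ (sub_ne_zero.2 htm) ?_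
    linear_combination hfd
  have hA := deriv_coeff hdA hdG₂ ht₂
    (fun y => by rw [← ha y, hAdef]; simp only; rw [div_mul_cancel₀ _ (hg y)]) pG₂
  have hB := deriv_coeff hdB hdG₁ ht₁
    (fun y => by rw [← hb y, hBdef]; simp only; rw [div_mul_cancel₀ _ (hg y)]) pG₁
  have key := gauge_relation_permutCorrection hm₁ hm₂ (hG₁ x) (hG₂ x) (hg x) (ha x) (hb x)
    hgauge hA hB
  rw [← key]
  congr 1
  have hasA := ((hdA x).hasFDerivAt.const_mul ((m₂ - m₁) / m₁)).smul (hdG₁ x).hasFDerivAt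
  have hasB := ((hdB x).hasFDerivAt.const_mul ((m₁ - m₂) / m₂)).smul (hdG₂ x).hasFDerivAt
  have hall := (hs x).hasFDerivAt.add ((hasA.add hasB).const_smul t)
  have hval := congrArg (fun L => L e) hall.fderiv
  refine hval.trans ?_
  simp only [add_apply, smul_apply,
    ContinuousLinearMap.smulRight_apply, ps, pG₁, pG₂, smul_eq_mul, hAdef, hBdef]
  module

end Permutability

section TransformedCoefficients

variable {n : ℕ}

/-- The coefficients of the conserved quantity of the fourth surface. -/
def permutCoeff (m₁ m₂ : ℝ) (d : ℕ) (c : ℕ → Surf → MV n) (G₁ G₂ : Surf → MV n) :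
    ℕ → Surf → MV n
  | 0 => c 0
  | j + 1 => fun x => c (j + 1) x + permutCorrection m₁ m₂ (G₁ x) (G₂ x)
      (quotCoeff m₂ d (fun k => c k x) j) (quotCoeff m₁ d (fun k => c k x) j)

lemma sum_permutCoeff (m₁ m₂ : ℝ) (d : ℕ) (c : ℕ → Surf → MV n) (G₁ G₂ : Surf → MV n)
    (t : ℝ) (x : Surf) :
    ∑ k ∈ Finset.range (d + 1), t ^ k • permutCoeff m₁ m₂ d c G₁ G₂ k x
      = ∑ k ∈ Finset.range (d + 1), t ^ k • c k x
        + t • permutCorrection m₁ m₂ (G₁ x) (G₂ x)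
          (∑ j ∈ Finset.range d, t ^ j • quotCoeff m₂ d (fun k => c k x) j)
          (∑ j ∈ Finset.range d, t ^ j • quotCoeff m₁ d (fun k => c k x) j) := by
  rw [Finset.sum_range_succ', Finset.sum_range_succ', ← sum_smul_permutCorrection,
    Finset.smul_sum, add_right_comm, ← Finset.sum_add_distrib]
  congr 1
  refine Finset.sum_congr rfl fun j _ => ?_
  rw [permutCoeff, smul_add, pow_succ', mul_smul t (t ^ j) (permutCorrection _ _ _ _ _ _)]

lemma contDiff_quotCoeff (m : ℝ) (d : ℕ) {c : ℕ → Surf → MV n}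
    (hc : ∀ k, ContDiff ℝ (⊤ : ℕ∞) (c k)) (j : ℕ) :
    ContDiff ℝ (⊤ : ℕ∞) fun x => quotCoeff m d (fun k => c k x) j := by
  refine ContDiff.sum fun k _ => ?_
  split_ifs
  · exact (hc k).const_smul _
  · exact contDiff_const

lemma contDiff_permutCoeff (m₁ m₂ : ℝ) (d : ℕ) {c : ℕ → Surf → MV n} {G₁ G₂ : Surf → MV n}
    (hc : ∀ k, ContDiff ℝ (⊤ : ℕ∞) (c k)) (hG₁ : ContDiff ℝ (⊤ : ℕ∞) G₁)
    (hG₂ : ContDiff ℝ (⊤ : ℕ∞) G₂) (hg : ∀ x, mink n (G₁ x) (G₂ x) ≠ 0) (k : ℕ) :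
    ContDiff ℝ (⊤ : ℕ∞) (permutCoeff m₁ m₂ d c G₁ G₂ k) := by
  cases k with
  | zero => exact hc 0
  | succ j =>
    have h₁ := contDiff_mink hG₁ hG₂
    have hA := (contDiff_mink (contDiff_quotCoeff m₂ d hc j) hG₂).div h₁ hg
    have hB := (contDiff_mink (contDiff_quotCoeff m₁ d hc j) hG₁).div h₁ hg
    exact (hc (j + 1)).add (((contDiff_const.mul hA).smul hG₁).add
      ((contDiff_const.mul hB).smul hG₂))

/-- A polynomial family of sections which is parallel for all but finitely many values of the
parameter is parallel for all values. -/
lemma parallelSection_sum_of_finite (S : IsothermicSurface n) {d : ℕ} {c : ℕ → Surf → MV n}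
    (hc : ∀ k, Differentiable ℝ (c k)) {E : Set ℝ} (hE : E.Finite)
    (h : ∀ t ∉ E, ParallelSection n S t fun x => ∑ k ∈ Finset.range (d + 1), t ^ k • c k x)
    (t : ℝ) : ParallelSection n S t fun x => ∑ k ∈ Finset.range (d + 1), t ^ k • c k x := by
  have hdense : Dense Eᶜ := hE.countable.dense_compl ℝ
  have main (x e : Surf) (W : MV n)
      (hW : ∀ t ∉ E, fderiv ℝ (fun x => ∑ k ∈ Finset.range (d + 1), t ^ k • c k x) x e
        + t • wedge n (S.F x) W (∑ k ∈ Finset.range (d + 1), t ^ k • c k x) = 0) :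
      fderiv ℝ (fun x => ∑ k ∈ Finset.range (d + 1), t ^ k • c k x) x e
        + t • wedge n (S.F x) W (∑ k ∈ Finset.range (d + 1), t ^ k • c k x) = 0 := by
    refine congrFun (Continuous.ext_on hdense ?_ continuous_const hW) t
    have hf (r : ℝ) : fderiv ℝ (fun x => ∑ k ∈ Finset.range (d + 1), r ^ k • c k x) x e
        = ∑ k ∈ Finset.range (d + 1), r ^ k • fderiv ℝ (c k) x e := by
      rw [(HasFDerivAt.fun_sum fun k _ => ((hc k) x).hasFDerivAt.fun_const_smul (r ^ k)).fderiv]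
      simp
    simp only [hf, wedge, ← minkForm_apply]
    fun_prop
  exact fun x => ⟨main x du _ fun r hr => (h r hr x).1, main x dv _ fun r hr => (h r hr x).2⟩

end TransformedCoefficients

/-- Bianchi permutability for special isothermic surfaces: if
`p(m₁) ⊥ Λ₁` and `p(m₂) ⊥ Λ₂` then the fourth surface is special isothermic
of type `d` with `p̂(0) = p(0)` and `(p̂(t),p̂(t)) = (p(t),p(t))`. -/
theorem bianchi_permutability_special (n d : ℕ) (S : IsothermicSurface n)
    (m₁ m₂ : ℝ) (hm₁ : m₁ ≠ 0) (hm₂ : m₂ ≠ 0) (hne : m₁ ≠ m₂)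
    (D₁ : DarbouxTransform n S m₁) (D₂ : DarbouxTransform n S m₂)
    (hdisj : ∀ x, D₁.G x ∉ Submodule.span ℝ {D₂.G x})
    (T : IsothermicSurface n)
    (hT : IsPermutabilityFourth n S m₁ m₂ D₁ D₂ T)
    (p : PolyConservedQuantity n S d)
    (h1 : ∀ x, mink n (pcEval p m₁ x) (D₁.G x) = 0)
    (h2 : ∀ x, mink n (pcEval p m₂ x) (D₂.G x) = 0) :
    ∃ ph : PolyConservedQuantity n T d,
      (∀ x, ph.coeff 0 x = p.coeff 0 x)
      ∧ ∀ t x, mink n (pcEval ph t x) (pcEval ph t x)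
          = mink n (pcEval p t x) (pcEval p t x) := by
  have hg (x : Surf) : mink n (D₁.G x) (D₂.G x) ≠ 0 := fun h =>
    hdisj x (mem_span_of_mink_eq_zero (D₁.G_null x) (D₂.G_null x) (D₂.G_ne x) h)
  have quot {m : ℝ} {G : Surf → MV n} (h : ∀ x, mink n (pcEval p m x) (G x) = 0) (t : ℝ)
      (x : Surf) :
      (t - m) * mink n (∑ j ∈ Finset.range d, t ^ j • quotCoeff m d (fun k => p.coeff k x) j)
        (G x) = mink n (pcEval p t x) (G x) := by
    rw [← mink_smul_left, sub_smul_sum_quotCoeff, mink_sub_left]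
    exact (congrArg _ (h x)).trans (sub_zero _)
  have hsmooth := contDiff_permutCoeff m₁ m₂ d p.smooth D₁.smooth_G D₂.smooth_G hg
  have hdiff_sum {c : ℕ → Surf → MV n} (hc : ∀ k, ContDiff ℝ (⊤ : ℕ∞) (c k)) (t : ℝ) (N : ℕ) :
      Differentiable ℝ fun x => ∑ k ∈ Finset.range N, t ^ k • c k x :=
    (ContDiff.sum fun k _ => (hc k).const_smul (t ^ k)).differentiable (by simp)
  refine ⟨⟨permutCoeff m₁ m₂ d p.coeff D₁.G D₂.G, hsmooth, ?_, ?_, ?_⟩, fun x => rfl, ?_⟩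
  · intro k hk
    obtain ⟨j, rfl⟩ := Nat.exists_eq_succ_of_ne_zero (Nat.ne_zero_of_lt hk)
    funext x
    have hj : d ≤ j := Nat.lt_succ_iff.1 hk
    simp [permutCoeff, permutCorrection, quotCoeff_of_le _ hj, p.coeff_eq_zero _ hk,
      mink_zero_left]
  · obtain ⟨x, hx⟩ := Function.ne_iff.1 p.top_ne
    refine Function.ne_iff.2 ⟨x, ?_⟩
    cases d with
    | zero => exact hx
    | succ d =>
      simp only [permutCoeff, quotCoeff_last]
      exact add_permutCorrection_ne_zero hm₁ hm₂ (D₁.G_null x) (D₂.G_null x) (hg x) hx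
  · refine parallelSection_sum_of_finite T (fun k => (hsmooth k).differentiable (by simp))
      (Set.toFinite {m₁, m₂}) fun t ht => ?_
    simp only [Set.mem_insert_iff, Set.mem_singleton_iff, not_or] at ht
    simp only [sum_permutCoeff]
    intro x
    have key {e : Surf} {W W' : MV n} := fderiv_add_permutCorrection (e := e) (F := S.F x)
      (W := W) (F' := T.F x) (W' := W') hm₁ hm₂
      (hdiff_sum p.smooth t (d + 1)) (hdiff_sum (contDiff_quotCoeff m₂ d p.smooth) t d)
      (hdiff_sum (contDiff_quotCoeff m₁ d p.smooth) t d) (D₁.smooth_G.differentiable (by simp))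
      (D₂.smooth_G.differentiable (by simp)) D₁.G_null D₂.G_null hg (quot h2 t) (quot h1 t)
      ht.1 ht.2 (x := x)
    exact ⟨key (hT.2.1 x) (p.conserved t x).1 (D₁.parallel x).1 (D₂.parallel x).1,
      key (hT.2.2 x) (p.conserved t x).2 (D₁.parallel x).2 (D₂.parallel x).2⟩
  · intro t x
    simp only [pcEval, sum_permutCoeff]
    exact mink_self_add_permutCorrection hm₁ hm₂ (D₁.G_null x) (D₂.G_null x) (hg x)
      (quot h2 t x) (quot h1 t x)
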